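/- Let {h_i}_{i∈I} generate a parabolic Cantor set and let ℙ be a weakly quasi-Bernoulli Borel probability measure on Σ. Then for every s ∈ ℝ and q ≥ 0 the limit P(s,q) := lim_{n→∞} (∑_{i∈I^n} ℙ([i])^q ‖h_i'‖_∞^s)^{1/n} exists. -/

import Mathlib

open Set Filter MeasureTheory Metric Topology
open scoped ENNReal NNReal

/-- Composition of the maps along a finite word: `h_{i₁…iₙ} = h_{i₁} ∘ ⋯ ∘ h_{iₙ}`. -/
def wMap {I : Type} (h : I → ℝ → ℝ) : List I → ℝ → ℝ
  | [] => id
  | a :: t => h a ∘ wMap h t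

/-- Derivative cocycle of the composition along a finite word (chain rule). -/
def wDeriv {I : Type} (h h' : I → ℝ → ℝ) : List I → ℝ → ℝ
  | [] => fun _ => 1
  | a :: t => fun x => h' a (wMap h t x) * wDeriv h h' t x

/-- `‖h_w'‖_∞`, the sup of `|h_w'|` over `[0,1]`. -/
noncomputable def supD {I : Type} (h h' : I → ℝ → ℝ) (w : List I) : ℝ :=
  ⨆ x : Icc (0:ℝ) 1, |wDeriv h h' w x|

/-- The cylinder of infinite words beginning with the finite word `w`. -/
def cyl {I : Type} (w : List I) : Set (ℕ → I) := {ω | ∀ k : Fin w.length, ω k = w.get k}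

/-- A parabolic IFS on `[0,1]` satisfying A1', A2', A3' (parabolic Cantor set system). -/
structure PCantorIFS (I : Type) [Fintype I] where
  h : I → ℝ → ℝ
  h' : I → ℝ → ℝ
  αh : ℝ
  αh_pos : 0 < αh
  card : 2 ≤ Fintype.card I
  maps : ∀ i, MapsTo (h i) (Icc (0:ℝ) 1) (Icc (0:ℝ) 1)
  contract : ∀ i, ∀ x ∈ Icc (0:ℝ) 1, ∀ y ∈ Icc (0:ℝ) 1, x ≠ y → |h i x - h i y| < |x - y|
  hasDeriv : ∀ i, ∀ x ∈ Icc (0:ℝ) 1, HasDerivWithinAt (h i) (h' i x) (Icc (0:ℝ) 1) x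
  holder : ∃ C > 0, ∀ i, ∀ x ∈ Icc (0:ℝ) 1, ∀ y ∈ Icc (0:ℝ) 1,
      |h' i x - h' i y| ≤ C * |x - y| ^ αh
  nonzero : ∀ i, ∀ x ∈ Icc (0:ℝ) 1, h' i x ≠ 0
  sep : ∀ i j, i ≠ j → Disjoint (h i '' Ioo (0:ℝ) 1) (h j '' Ioo (0:ℝ) 1)

/-- The induced (hyperbolic) alphabet `I_∞ = {j i₀ : j ∈ (I ∖ {i₀})^*} ∪ {i₀}`. -/
def Iinf {I : Type} (i0 : I) : Set (List I) :=
  {w | ∃ j : List I, (∀ a ∈ j, a ≠ i0) ∧ w = j ++ [i0]}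

/-- Finite concatenations of words from `I_∞`. -/
def IinfStar {I : Type} (i0 : I) : Set (List I) :=
  {w | ∃ L : List (List I), (∀ u ∈ L, u ∈ Iinf i0) ∧ w = L.flatten}

/-- The truncated induced alphabet `I_N`. -/
def IN {I : Type} (i0 : I) (N : ℕ) : Set (List I) :=
  {w | w ∈ Iinf i0 ∧ w.length ≤ N}

/-- The weak quasi-Bernoulli property. -/
def WeakQB {I : Type} [MeasurableSpace I] (P : Measure (ℕ → I)) : Prop :=
  ∃ c : ℕ → ℝ, (∀ n, 0 < c n) ∧
    Tendsto (fun n : ℕ => c n ^ ((n : ℝ)⁻¹)) atTop (𝓝 1) ∧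
    ∀ L : List (List I), (∀ w ∈ L, w ≠ []) →
      ((L.map fun w => c w.length).prod)⁻¹ * (L.map fun w => (P (cyl w)).toReal).prod
          ≤ (P (cyl L.flatten)).toReal ∧
        (P (cyl L.flatten)).toReal
          ≤ (L.map fun w => c w.length).prod * (L.map fun w => (P (cyl w)).toReal).prod

/-- The quasi-Bernoulli property restricted to concatenations of words from `I_∞`. -/
def QBonInf {I : Type} [MeasurableSpace I] (P : Measure (ℕ → I)) (i0 : I) : Prop :=
  ∃ c : ℝ, 1 ≤ c ∧ ∀ u ∈ IinfStar i0, ∀ v ∈ IinfStar i0,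
    c⁻¹ * ((P (cyl u)).toReal * (P (cyl v)).toReal) ≤ (P (cyl (u ++ v))).toReal ∧
    (P (cyl (u ++ v))).toReal ≤ c * ((P (cyl u)).toReal * (P (cyl v)).toReal)

/-- The partition sums `∑_{i ∈ I^n} ℙ([i])^q ‖h_i'‖_∞^s` over the full alphabet. -/
noncomputable def pSum {I : Type} [Fintype I] [MeasurableSpace I]
    (P : Measure (ℕ → I)) (h h' : I → ℝ → ℝ) (n : ℕ) (s q : ℝ) : ℝ :=
  ∑ w : Fin n → I, (P (cyl (List.ofFn w))).toReal ^ q * supD h h' (List.ofFn w) ^ s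

/-- The partition sums over `n`-fold concatenations of words from an alphabet `J` of
finite words. -/
noncomputable def zSum {I : Type} [MeasurableSpace I]
    (P : Measure (ℕ → I)) (h h' : I → ℝ → ℝ) (J : Set (List I)) (n : ℕ) (s q : ℝ) : ℝ :=
  ∑' w : Fin n → ↥J,
    (P (cyl (List.flatten (List.ofFn fun k => ((w k : List I)))))).toReal ^ q *
      supD h h' (List.flatten (List.ofFn fun k => ((w k : List I)))) ^ s

/-- `x ^ q` with the convention `0^0 = 0` used for moment sums. -/
noncomputable def pw (a q : ℝ) : ℝ := if a = 0 then 0 else a ^ q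

/-- The `q`-th moment sum of a measure on `ℝ` over the closed intervals of the `δ`-mesh. -/
noncomputable def Dq1 (ν : Measure ℝ) (q δ : ℝ) : ℝ :=
  ∑' k : ℤ, pw ((ν (Icc ((k : ℝ) * δ) (((k : ℝ) + 1) * δ))).toReal) q

/-- Number of intervals of the `δ`-mesh which intersect `F ⊆ ℝ`. -/
noncomputable def covCount (F : Set ℝ) (δ : ℝ) : ℕ :=
  Set.ncard {k : ℤ | (Icc ((k : ℝ) * δ) (((k : ℝ) + 1) * δ) ∩ F).Nonempty}

/-- A variant of Fekete's lemma: subadditivity along all blocks, up to sublinear errors. -/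
lemma exists_tendsto_div_of_block_subadditive {b ε : ℕ → ℝ} {D : ℝ}
    (hε : Tendsto (fun n : ℕ => ε n / n) atTop (𝓝 0))
    (hb : ∀ k n r : ℕ, 0 < n → 0 < r → b (k * n + r) ≤ k * (b n + ε n) + (b r + ε r))
    (hD : ∀ n : ℕ, D * n ≤ b n) :
    ∃ L : ℝ, Tendsto (fun n : ℕ => b n / n) atTop (𝓝 L) := by
  obtain ⟨B, hB⟩ := hε.bddBelow_range
  have hbdd : BddBelow ((fun n : ℕ => (b n + ε n) / n) '' Ioi 0) := by
    refine ⟨D + B, ?_⟩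
    rintro _ ⟨n, hn, rfl⟩
    have hn' : (0 : ℝ) < n := Nat.cast_pos.2 hn
    have h1 : D ≤ b n / n := (le_div_iff₀ hn').2 (hD n)
    have h2 : B ≤ ε n / n := hB ⟨n, rfl⟩
    change D + B ≤ (b n + ε n) / n
    rw [add_div]
    linarith
  refine ⟨sInf ((fun n : ℕ => (b n + ε n) / n) '' Ioi 0), tendsto_order.2 ⟨?_, ?_⟩⟩
  · intro x hx
    filter_upwards [hε.eventually (gt_mem_nhds (sub_pos.2 hx)), eventually_gt_atTop 0]
      with n hn hn0
    have h1 := csInf_le hbdd ⟨n, hn0, rfl⟩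
    simp only [add_div] at h1 hn ⊢
    linarith
  · intro x hx
    obtain ⟨_, ⟨n, hn, rfl⟩, hnx⟩ := exists_lt_of_csInf_lt (Set.Nonempty.image _ ⟨1, Nat.one_pos⟩) hx
    have hn' : (0 : ℝ) < n := Nat.cast_pos.2 hn
    set y := (b n + ε n) / n with hy
    obtain ⟨M, hM⟩ := ((Finset.range (n + 1)).image
      (fun r : ℕ => b r + ε r - r * y)).bddAbove
    have hlim : Tendsto (fun N : ℕ => y + M / N) atTop (𝓝 (y + 0)) :=
      tendsto_const_nhds.add (tendsto_const_div_atTop_nhds_zero_nat M)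
    rw [add_zero] at hlim
    filter_upwards [hlim.eventually (gt_mem_nhds hnx), eventually_gt_atTop 0] with N hN hN0
    refine lt_of_le_of_lt ?_ hN
    have hN' : (0 : ℝ) < N := Nat.cast_pos.2 hN0
    have hdecomp : (N - 1) / n * n + ((N - 1) % n + 1) = N := by
      have := Nat.div_add_mod' (N - 1) n
      omega
    have hr : (N - 1) % n + 1 ∈ Finset.range (n + 1) := by
      have := Nat.mod_lt (N - 1) hn
      simp only [Finset.mem_range]
      omega
    have key := hb ((N - 1) / n) n ((N - 1) % n + 1) hn (Nat.succ_pos _)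
    have hMr := hM (Finset.mem_coe.2 (Finset.mem_image_of_mem _ hr))
    rw [hdecomp] at key
    have hcast : (((N - 1) / n : ℕ) : ℝ) * n + (((N - 1) % n + 1 : ℕ) : ℝ) = N := by
      exact_mod_cast hdecomp
    have hyn : b n + ε n = y * n := by rw [hy]; field_simp
    rw [hyn] at key
    generalize (((N - 1) / n : ℕ) : ℝ) = k at *
    generalize (N - 1) % n + 1 = r at *
    have hkn : k * (y * n) = (N - r) * y := by rw [← hcast]; ring
    rw [div_le_iff₀ hN', add_mul, div_mul_cancel₀ _ hN'.ne']
    linarith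

/-- The sum of a function over the words of length `n`. -/
def wordSum {I : Type} [Fintype I] (F : List I → ℝ) (n : ℕ) : ℝ :=
  ∑ w : Fin n → I, F (List.ofFn w)

lemma wordSum_add {I : Type} [Fintype I] (F : List I → ℝ) (m n : ℕ) :
    wordSum F (m + n) = ∑ u : Fin m → I, wordSum (fun v => F (List.ofFn u ++ v)) n := by
  unfold wordSum
  rw [← (Fin.appendEquiv m n).sum_comp, Fintype.sum_prod_type]
  simp [Fin.appendEquiv, List.ofFn_fin_append]

/-- Block inequalities between word functions pass to word sums. The sign of `σ` decides the
direction of the inequality. -/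
lemma wordSum_block_le {I : Type} [Fintype I] {F : List I → ℝ} {e : ℕ → ℝ} {σ : ℝ}
    (hF : ∀ L : List (List I), (∀ w ∈ L, w ≠ []) →
      σ * F L.flatten ≤ σ * (L.map fun w => e w.length * F w).prod)
    {n r : ℕ} (hn : 0 < n) (hr : 0 < r) (k : ℕ) :
    ∀ L : List (List I), (∀ w ∈ L, w ≠ []) →
      σ * wordSum (fun v => F (L.flatten ++ v)) (k * n + r) ≤
        σ * ((L.map fun w => e w.length * F w).prod *
          ((e n * wordSum F n) ^ k * (e r * wordSum F r))) := by
  have hne : ∀ {m : ℕ}, 0 < m → ∀ L : List (List I), (∀ w ∈ L, w ≠ []) →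
      ∀ u : Fin m → I, ∀ w ∈ L ++ [List.ofFn u], w ≠ [] := by
    intro m hm L hL u w hw
    rcases List.mem_append.1 hw with hw | hw
    · exact hL w hw
    · rw [List.mem_singleton.1 hw, ne_eq, List.ofFn_eq_nil_iff]
      exact hm.ne'
  induction k with
  | zero =>
    intro L hL
    rw [zero_mul, zero_add, pow_zero, one_mul]
    simp only [wordSum, Finset.mul_sum]
    refine Finset.sum_le_sum fun v _ => ?_
    simpa using hF _ (hne hr L hL v)
  | succ k ih =>
    intro L hL
    rw [show (k + 1) * n + r = n + (k * n + r) by ring, wordSum_add, Finset.mul_sum]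
    have hstep : ∀ u : Fin n → I,
        σ * wordSum (fun v => F (L.flatten ++ (List.ofFn u ++ v))) (k * n + r) ≤
        σ * (((L.map fun w => e w.length * F w).prod * (e n * F (List.ofFn u))) *
          ((e n * wordSum F n) ^ k * (e r * wordSum F r))) := by
      intro u
      simpa using ih _ (hne hn L hL u)
    refine le_trans (Finset.sum_le_sum (s := Finset.univ) fun u _ => hstep u) (le_of_eq ?_)
    simp only [← Finset.mul_sum, ← Finset.sum_mul]
    rw [pow_succ]
    unfold wordSum
    ring

/-- Word sums of a function that is sub- (`σ = 1`) or super- (`σ = -1`) multiplicative along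
blocks, up to subexponential factors, have an exponential growth rate. -/
lemma exists_tendsto_wordSum_rpow {I : Type} [Fintype I] {F : List I → ℝ} {e : ℕ → ℝ} {σ D : ℝ}
    (hσ : σ = 1 ∨ σ = -1) (he : ∀ n, 0 < e n)
    (hlim : Tendsto (fun n : ℕ => Real.log (e n) / n) atTop (𝓝 0))
    (hpos : ∀ n, 0 < wordSum F n)
    (hF : ∀ L : List (List I), (∀ w ∈ L, w ≠ []) →
      σ * F L.flatten ≤ σ * (L.map fun w => e w.length * F w).prod)
    (hD : ∀ n : ℕ, D * n ≤ σ * Real.log (wordSum F n)) :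
    ∃ L : ℝ, Tendsto (fun n : ℕ => wordSum F n ^ ((n : ℝ)⁻¹)) atTop (𝓝 L) := by
  have hσσ : σ * σ = 1 := by rcases hσ with rfl | rfl <;> norm_num
  obtain ⟨L, hL⟩ := exists_tendsto_div_of_block_subadditive
    (b := fun n => σ * Real.log (wordSum F n)) (ε := fun n => σ * Real.log (e n)) (D := D)
    (by simpa [mul_div_assoc] using hlim.const_mul σ)
    (by
      intro k n r hn hr
      have key := wordSum_block_le hF hn hr k [] (by simp)
      simp only [List.flatten_nil, List.nil_append, List.map_nil, List.prod_nil, one_mul] at key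
      have hn0 := mul_pos (he n) (hpos n)
      have hr0 := mul_pos (he r) (hpos r)
      have hexp : Real.log ((e n * wordSum F n) ^ k * (e r * wordSum F r)) =
          k * (Real.log (wordSum F n) + Real.log (e n)) +
            (Real.log (wordSum F r) + Real.log (e r)) := by
        rw [Real.log_mul (pow_pos hn0 k).ne' hr0.ne', Real.log_pow,
          Real.log_mul (he n).ne' (hpos n).ne', Real.log_mul (he r).ne' (hpos r).ne']
        ring
      have hlog : σ * Real.log (wordSum F (k * n + r)) ≤
          σ * Real.log ((e n * wordSum F n) ^ k * (e r * wordSum F r)) := by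
        rcases hσ with rfl | rfl
        · simp only [one_mul] at key ⊢
          exact Real.log_le_log (hpos _) key
        · simp only [neg_mul, one_mul, neg_le_neg_iff] at key ⊢
          exact Real.log_le_log (mul_pos (pow_pos hn0 k) hr0) key
      rw [hexp] at hlog
      linarith)
    hD
  refine ⟨Real.exp (σ * L), ?_⟩
  refine ((Real.continuous_exp.tendsto _).comp (hL.const_mul σ)).congr fun n => ?_
  rw [Real.rpow_def_of_pos (hpos n), Function.comp_apply, ← mul_div_assoc, ← mul_assoc, hσσ,
    one_mul, div_eq_mul_inv]

lemma univ_subset_iUnion_cyl {I : Type} (n : ℕ) :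
    (univ : Set (ℕ → I)) ⊆ ⋃ w : Fin n → I, cyl (List.ofFn w) := by
  intro ω _
  refine mem_iUnion.2 ⟨fun k => ω k, fun k => ?_⟩
  simp

lemma exists_inv_card_pow_le_cyl {I : Type} [Fintype I] [Nonempty I] [MeasurableSpace I]
    (P : Measure (ℕ → I)) [IsProbabilityMeasure P] (n : ℕ) :
    ∃ w : Fin n → I, ((Fintype.card I : ℝ)⁻¹) ^ n ≤ (P (cyl (List.ofFn w))).toReal := by
  have h1 : (1 : ℝ≥0∞) ≤ ∑ w : Fin n → I, P (cyl (List.ofFn w)) := by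
    rw [← measure_univ (μ := P)]
    exact (measure_mono (univ_subset_iUnion_cyl n)).trans (measure_iUnion_fintype_le _ _)
  have h2 : (1 : ℝ) ≤ ∑ w : Fin n → I, (P (cyl (List.ofFn w))).toReal := by
    rw [← ENNReal.toReal_sum fun w _ => measure_ne_top _ _]
    have := ENNReal.toReal_mono
      (ENNReal.sum_ne_top.2 fun (w : Fin n → I) _ => measure_ne_top P (cyl (List.ofFn w))) h1
    simpa using this
  have h3 : ∑ _w : Fin n → I, ((Fintype.card I : ℝ)⁻¹) ^ n ≤
      ∑ w : Fin n → I, (P (cyl (List.ofFn w))).toReal := by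
    refine le_trans (le_of_eq ?_) h2
    have hc : (Fintype.card I : ℝ) ≠ 0 := Nat.cast_ne_zero.2 Fintype.card_ne_zero
    simp [hc]
  obtain ⟨w, -, hw⟩ := Finset.exists_le_of_sum_le Finset.univ_nonempty h3
  exact ⟨w, hw⟩

lemma mapsTo_wMap {I : Type} {h : I → ℝ → ℝ} {s : Set ℝ} (hs : ∀ i, MapsTo (h i) s s)
    (w : List I) : MapsTo (wMap h w) s s := by
  induction w with
  | nil => exact mapsTo_id s
  | cons a t ih => exact (hs a).comp ih

lemma wMap_append {I : Type} (h : I → ℝ → ℝ) (u v : List I) (x : ℝ) :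
    wMap h (u ++ v) x = wMap h u (wMap h v x) := by
  induction u with
  | nil => rfl
  | cons a t ih => simp [wMap, ih]

lemma wDeriv_append {I : Type} (h h' : I → ℝ → ℝ) (u v : List I) (x : ℝ) :
    wDeriv h h' (u ++ v) x = wDeriv h h' u (wMap h v x) * wDeriv h h' v x := by
  induction u with
  | nil => simp [wDeriv]
  | cons a t ih => simp [wDeriv, ih, wMap_append, mul_assoc]

namespace PCantorIFS

variable {I : Type} [Fintype I]

lemma nonempty (S : PCantorIFS I) : Nonempty I :=
  Fintype.card_pos_iff.1 (lt_of_lt_of_le two_pos S.card)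

variable (S : PCantorIFS I)

lemma continuousOn_deriv (i : I) : ContinuousOn (S.h' i) (Icc 0 1) := by
  obtain ⟨C, -, hC⟩ := S.holder
  intro x hx
  rw [ContinuousWithinAt, tendsto_iff_dist_tendsto_zero]
  have hc : Continuous fun y : ℝ => C * |y - x| ^ S.αh :=
    continuous_const.mul
      ((continuous_id.sub continuous_const).abs.rpow_const fun _ => Or.inr S.αh_pos.le)
  have hlim : Tendsto (fun y : ℝ => C * |y - x| ^ S.αh) (𝓝[Icc 0 1] x) (𝓝 0) := by
    have := (hc.tendsto x).mono_left (nhdsWithin_le_nhds (s := Icc 0 1))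
    simpa [Real.zero_rpow S.αh_pos.ne'] using this
  refine squeeze_zero' (Eventually.of_forall fun _ => dist_nonneg) ?_ hlim
  filter_upwards [self_mem_nhdsWithin] with y hy
  exact hC i y hy x hx

lemma exists_deriv_bounds : ∃ m M : ℝ, 0 < m ∧
    ∀ i, ∀ x ∈ Icc (0 : ℝ) 1, m ≤ |S.h' i x| ∧ |S.h' i x| ≤ M := by
  have : Nonempty I := S.nonempty
  have hcpt : IsCompact (Icc (0 : ℝ) 1) := isCompact_Icc
  have hne : (Icc (0 : ℝ) 1).Nonempty := ⟨0, by simp⟩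
  choose a ha hmin using fun i => hcpt.exists_isMinOn hne (S.continuousOn_deriv i).abs
  choose b hb hmax using fun i => hcpt.exists_isMaxOn hne (S.continuousOn_deriv i).abs
  obtain ⟨i₀, hi₀⟩ := Finite.exists_min fun i => |S.h' i (a i)|
  obtain ⟨i₁, hi₁⟩ := Finite.exists_max fun i => |S.h' i (b i)|
  exact ⟨|S.h' i₀ (a i₀)|, |S.h' i₁ (b i₁)|, abs_pos.2 (S.nonzero _ _ (ha _)),
    fun i x hx => ⟨(hi₀ i).trans (hmin i hx), (hmax i hx : _ ≤ _).trans (hi₁ i)⟩⟩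

lemma le_abs_wDeriv {m : ℝ} (hm : 0 < m) (h : ∀ i, ∀ x ∈ Icc (0 : ℝ) 1, m ≤ |S.h' i x|)
    (w : List I) {x : ℝ} (hx : x ∈ Icc (0 : ℝ) 1) :
    m ^ w.length ≤ |wDeriv S.h S.h' w x| := by
  induction w with
  | nil => simp [wDeriv]
  | cons a t ih =>
    rw [List.length_cons, pow_succ', wDeriv, abs_mul]
    exact mul_le_mul (h a _ (mapsTo_wMap S.maps t hx)) ih (pow_pos hm _).le (abs_nonneg _)

lemma bddAbove_abs_wDeriv (w : List I) :
    BddAbove (range fun x : Icc (0 : ℝ) 1 => |wDeriv S.h S.h' w x|) := by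
  obtain ⟨m, M, hm, h⟩ := S.exists_deriv_bounds
  refine ⟨M ^ w.length, ?_⟩
  rintro _ ⟨⟨x, hx⟩, rfl⟩
  induction w with
  | nil => simp [wDeriv]
  | cons a t ih =>
    have ha := h a _ (mapsTo_wMap S.maps t hx)
    simp only [List.length_cons, pow_succ', wDeriv, abs_mul]
    exact mul_le_mul ha.2 ih (abs_nonneg _) (hm.le.trans (ha.1.trans ha.2))

lemma abs_wDeriv_le_supD (w : List I) {x : ℝ} (hx : x ∈ Icc (0 : ℝ) 1) :
    |wDeriv S.h S.h' w x| ≤ supD S.h S.h' w :=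
  le_ciSup (S.bddAbove_abs_wDeriv w) ⟨x, hx⟩

lemma exists_pow_le_supD : ∃ m : ℝ, 0 < m ∧ ∀ w : List I, m ^ w.length ≤ supD S.h S.h' w := by
  obtain ⟨m, M, hm, h⟩ := S.exists_deriv_bounds
  have h0 : (0 : ℝ) ∈ Icc (0 : ℝ) 1 := by simp
  exact ⟨m, hm, fun w => (S.le_abs_wDeriv hm (fun i x hx => (h i x hx).1) w h0).trans
    (S.abs_wDeriv_le_supD w h0)⟩

lemma supD_pos (w : List I) : 0 < supD S.h S.h' w := by
  obtain ⟨m, hm, h⟩ := S.exists_pow_le_supD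
  exact (pow_pos hm _).trans_le (h w)

lemma supD_append_le (u v : List I) :
    supD S.h S.h' (u ++ v) ≤ supD S.h S.h' u * supD S.h S.h' v := by
  have : Nonempty (Icc (0 : ℝ) 1) := ⟨⟨0, by simp⟩⟩
  refine ciSup_le fun x => ?_
  rw [wDeriv_append, abs_mul]
  exact mul_le_mul (S.abs_wDeriv_le_supD u (mapsTo_wMap S.maps v x.2))
    (S.abs_wDeriv_le_supD v x.2) (abs_nonneg _) (S.supD_pos u).le

lemma supD_flatten_le (L : List (List I)) :
    supD S.h S.h' L.flatten ≤ (L.map (supD S.h S.h')).prod := by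
  induction L with
  | nil =>
    have : Nonempty (Icc (0 : ℝ) 1) := ⟨⟨0, by simp⟩⟩
    simp [supD, wDeriv]
  | cons u L ih =>
    rw [List.flatten_cons, List.map_cons, List.prod_cons]
    exact (S.supD_append_le u _).trans (mul_le_mul_of_nonneg_left ih (S.supD_pos u).le)

variable [MeasurableSpace I] (P : Measure (ℕ → I))

/-- The summand `ℙ([w])^q ‖h_w'‖^s` of the partition sum. -/
noncomputable def weight (s q : ℝ) (w : List I) : ℝ :=
  (P (cyl w)).toReal ^ q * supD S.h S.h' w ^ s

lemma weight_nonneg (s q : ℝ) (w : List I) : 0 ≤ S.weight P s q w :=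
  mul_nonneg (Real.rpow_nonneg ENNReal.toReal_nonneg q) (Real.rpow_nonneg (S.supD_pos w).le s)

variable [IsProbabilityMeasure P]

lemma wordSum_weight_pos (s q : ℝ) (n : ℕ) : 0 < wordSum (S.weight P s q) n := by
  have : Nonempty I := S.nonempty
  obtain ⟨w, hw⟩ := exists_inv_card_pow_le_cyl P n
  have hc : (0 : ℝ) < (Fintype.card I : ℝ)⁻¹ := inv_pos.2 (Nat.cast_pos.2 Fintype.card_pos)
  refine Finset.sum_pos' (fun v _ => S.weight_nonneg P s q _) ⟨w, Finset.mem_univ w, ?_⟩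
  exact mul_pos (Real.rpow_pos_of_pos ((pow_pos hc n).trans_le hw) q)
    (Real.rpow_pos_of_pos (S.supD_pos _) s)

lemma exists_mul_le_log_wordSum {s q : ℝ} (hs : 0 ≤ s) (hq : 0 ≤ q) :
    ∃ D : ℝ, ∀ n : ℕ, D * n ≤ Real.log (wordSum (S.weight P s q) n) := by
  have : Nonempty I := S.nonempty
  obtain ⟨m, hm, hsup⟩ := S.exists_pow_le_supD
  have hc : (0 : ℝ) < (Fintype.card I : ℝ)⁻¹ := inv_pos.2 (Nat.cast_pos.2 Fintype.card_pos)
  refine ⟨q * Real.log (Fintype.card I : ℝ)⁻¹ + s * Real.log m, fun n => ?_⟩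
  obtain ⟨w, hw⟩ := exists_inv_card_pow_le_cyl P n
  have hcn := pow_pos hc n
  have hmn := pow_pos hm n
  have hle : (((Fintype.card I : ℝ)⁻¹) ^ n) ^ q * (m ^ n) ^ s ≤ wordSum (S.weight P s q) n := by
    refine le_trans ?_ (Finset.single_le_sum (f := fun v : Fin n → I =>
      S.weight P s q (List.ofFn v)) (fun v _ => S.weight_nonneg P s q _) (Finset.mem_univ w))
    have := hsup (List.ofFn w)
    rw [List.length_ofFn] at this
    exact mul_le_mul (Real.rpow_le_rpow hcn.le hw hq) (Real.rpow_le_rpow hmn.le this hs)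
      (Real.rpow_nonneg hmn.le s) (Real.rpow_nonneg ENNReal.toReal_nonneg q)
  have hcq := Real.rpow_pos_of_pos hcn q
  have hms := Real.rpow_pos_of_pos hmn s
  refine le_trans (le_of_eq ?_) (Real.log_le_log (mul_pos hcq hms) hle)
  rw [Real.log_mul hcq.ne' hms.ne', Real.log_rpow hcn, Real.log_rpow hmn, Real.log_pow,
    Real.log_pow]
  ring

lemma exists_log_wordSum_le_mul {s q : ℝ} (hs : s ≤ 0) (hq : 0 ≤ q) :
    ∃ D : ℝ, ∀ n : ℕ, Real.log (wordSum (S.weight P s q) n) ≤ D * n := by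
  have : Nonempty I := S.nonempty
  obtain ⟨m, hm, hsup⟩ := S.exists_pow_le_supD
  have hc : (0 : ℝ) < Fintype.card I := Nat.cast_pos.2 Fintype.card_pos
  refine ⟨Real.log (Fintype.card I : ℝ) + s * Real.log m, fun n => ?_⟩
  have hmn := pow_pos hm n
  have hle : wordSum (S.weight P s q) n ≤ (Fintype.card I : ℝ) ^ n * (m ^ n) ^ s := by
    have hterm : ∀ w ∈ (Finset.univ : Finset (Fin n → I)),
        S.weight P s q (List.ofFn w) ≤ (m ^ n) ^ s := by
      intro w _
      have := hsup (List.ofFn w)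
      rw [List.length_ofFn] at this
      refine (mul_le_of_le_one_left (Real.rpow_nonneg (S.supD_pos _).le s) ?_).trans
        (Real.rpow_le_rpow_of_nonpos hmn this hs)
      exact Real.rpow_le_one ENNReal.toReal_nonneg measureReal_le_one hq
    refine (Finset.sum_le_sum hterm).trans_eq ?_
    simp
  have hms := Real.rpow_pos_of_pos hmn s
  refine (Real.log_le_log (S.wordSum_weight_pos P s q n) hle).trans_eq ?_
  rw [Real.log_mul (pow_pos hc n).ne' hms.ne', Real.log_rpow hmn, Real.log_pow, Real.log_pow]
  ring

end PCantorIFS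

lemma rpow_prod_map_mul {ι : Type} (L : List ι) {f g : ι → ℝ} (hf : ∀ i, 0 ≤ f i)
    (hg : ∀ i, 0 ≤ g i) (q : ℝ) :
    ((L.map f).prod * (L.map g).prod) ^ q = (L.map fun i => f i ^ q * g i ^ q).prod := by
  induction L with
  | nil => simp
  | cons a L ih =>
    have h1 : 0 ≤ (L.map f).prod := List.prod_nonneg (by simpa using fun i _ => hf i)
    have h2 : 0 ≤ (L.map g).prod := List.prod_nonneg (by simpa using fun i _ => hg i)
    simp only [List.map_cons, List.prod_cons]
    rw [← ih, mul_mul_mul_comm,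
      Real.mul_rpow (mul_nonneg (hf a) (hg a)) (mul_nonneg h1 h2), Real.mul_rpow (hf a) (hg a)]

lemma rpow_prod_map {ι : Type} (L : List ι) {f : ι → ℝ} (hf : ∀ i, 0 ≤ f i) (q : ℝ) :
    (L.map f).prod ^ q = (L.map fun i => f i ^ q).prod := by
  simpa using rpow_prod_map_mul L hf (fun _ => zero_le_one) q

/-- For a weakly quasi-Bernoulli measure on a parabolic Cantor set, the
topological pressure `P(s,q) = lim_n (∑_{i ∈ Iⁿ} ℙ([i])^q ‖h_i'‖_∞^s)^{1/n}` exists for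
every `s ∈ ℝ` and `q ≥ 0`. -/
theorem pressure_exists {I : Type} [Fintype I] [MeasurableSpace I]
    (S : PCantorIFS I)
    (P : Measure (ℕ → I)) [IsProbabilityMeasure P]
    (hwqb : WeakQB P) :
    ∀ s q : ℝ, 0 ≤ q →
      ∃ L : ℝ, Tendsto (fun n : ℕ => pSum P S.h S.h' n s q ^ ((n : ℝ)⁻¹)) atTop (𝓝 L) := by
  intro s q hq
  obtain ⟨c, hc, hclim, hcyl⟩ := hwqb
  have hclog : Tendsto (fun n : ℕ => Real.log (c n) / n) atTop (𝓝 0) := by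
    have := hclim.log one_ne_zero
    rw [Real.log_one] at this
    refine this.congr fun n => ?_
    rw [Real.log_rpow (hc n), div_eq_inv_mul]
  have hP : ∀ w : List I, 0 ≤ (P (cyl w)).toReal := fun w => ENNReal.toReal_nonneg
  have hD : ∀ w : List I, 0 ≤ supD S.h S.h' w := fun w => (S.supD_pos w).le
  have hprod : ∀ (e : ℕ → ℝ) (L : List (List I)),
      (L.map fun w => e w.length * S.weight P s q w).prod =
        (L.map fun w => e w.length * (P (cyl w)).toReal ^ q).prod *
          (L.map (supD S.h S.h')).prod ^ s := by
    intro e L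
    rw [rpow_prod_map L hD, ← List.prod_map_mul]
    simp only [PCantorIFS.weight, mul_assoc]
  change ∃ L : ℝ, Tendsto (fun n : ℕ => wordSum (S.weight P s q) n ^ ((n : ℝ)⁻¹)) atTop (𝓝 L)
  rcases le_total 0 s with hs | hs
  · obtain ⟨D, hDle⟩ := S.exists_mul_le_log_wordSum P hs hq
    refine exists_tendsto_wordSum_rpow (e := fun n => c n ^ q) (Or.inl rfl)
      (fun n => Real.rpow_pos_of_pos (hc n) q) ?_ (S.wordSum_weight_pos P s q) ?_
      (by simpa using hDle)
    · simpa [Real.log_rpow (hc _), mul_div_assoc] using hclog.const_mul q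
    · intro L hL
      rw [one_mul, one_mul, hprod (fun n => c n ^ q), ← rpow_prod_map_mul L (fun w => (hc w.length).le) hP]
      have hle := (hcyl L hL).2
      exact mul_le_mul (Real.rpow_le_rpow (hP _) hle hq)
        (Real.rpow_le_rpow (hD _) (S.supD_flatten_le L) hs) (Real.rpow_nonneg (hD _) s)
        (Real.rpow_nonneg ((hP _).trans hle) q)
  · obtain ⟨D, hDle⟩ := S.exists_log_wordSum_le_mul P hs hq
    refine exists_tendsto_wordSum_rpow (D := -D) (e := fun n => (c n)⁻¹ ^ q) (Or.inr rfl)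
      (fun n => Real.rpow_pos_of_pos (inv_pos.2 (hc n)) q) ?_ (S.wordSum_weight_pos P s q) ?_
      (by simpa using hDle)
    · simpa [Real.log_rpow (inv_pos.2 (hc _)), mul_div_assoc, neg_div] using
        (hclog.const_mul q).neg
    · intro L hL
      rw [neg_one_mul, neg_one_mul, neg_le_neg_iff, hprod (fun n => (c n)⁻¹ ^ q),
        ← rpow_prod_map_mul L (fun w => (inv_pos.2 (hc w.length)).le) hP]
      have hle := (hcyl L hL).1
      rw [List.prod_inv, List.map_map] at hle
      have hnonneg : 0 ≤ (L.map fun w => (c w.length)⁻¹).prod *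
          (L.map fun w => (P (cyl w)).toReal).prod :=
        mul_nonneg (List.prod_nonneg (by simp [fun n => (hc n).le]))
          (List.prod_nonneg (by simp))
      exact mul_le_mul (Real.rpow_le_rpow hnonneg hle hq)
        (Real.rpow_le_rpow_of_nonpos (S.supD_pos _) (S.supD_flatten_le L) hs)
        (Real.rpow_nonneg ((hD _).trans (S.supD_flatten_le L)) s) (Real.rpow_nonneg (hP _) q)
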